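/- arXiv:1807.05112 — 2 statements merged into one kernel-verified Lean document; each statement's English description precedes it below -/
import Mathlib

section
/- Let X^LCP be the Lazy Capacity Provisioning schedule and let X* be the optimal schedule defined by the backward recursion x*_{T+1} = 0, x*_t = [x*_{t+1}]_{x^L_t}^{x^U_t}. For every τ ∈ {1,…,T}: if x^LCP_{τ−1} < x*_{τ−1} and x^LCP_τ ≥ x*_τ, then x^LCP_τ = x*_τ; and if x^LCP_{τ−1} > x*_{τ−1} and x^LCP_τ ≤ x*_τ, then x^LCP_τ = x*_τ. -/
open Finset

noncomputable section

/-- Feasibility of a (truncated) schedule for time horizon `τ` with `m` servers: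
`x 0 = 0` and `x t ∈ {0, …, m}` for `t ∈ {1, …, τ}`. -/
def Feas (τ m : ℕ) (x : ℕ → ℕ) : Prop :=
  x 0 = 0 ∧ ∀ t ∈ Finset.Icc 1 τ, x t ≤ m

/-- `C^L_τ(X) = ∑_{t=1}^τ f_t(x_t) + β ∑_{t=1}^τ (x_t − x_{t−1})⁺`
(switching cost charged for powering up). -/
def CL (τ : ℕ) (β : ℝ) (f : ℕ → ℕ → ℝ) (x : ℕ → ℕ) : ℝ :=
  ∑ t ∈ Finset.Icc 1 τ, f t (x t)
    + β * ∑ t ∈ Finset.Icc 1 τ, max ((x t : ℝ) - (x (t - 1) : ℝ)) 0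

/-- `C^U_τ(X) = ∑_{t=1}^τ f_t(x_t) + β ∑_{t=1}^τ (x_{t−1} − x_t)⁺`
(switching cost charged for powering down). -/
def CU (τ : ℕ) (β : ℝ) (f : ℕ → ℕ → ℝ) (x : ℕ → ℕ) : ℝ :=
  ∑ t ∈ Finset.Icc 1 τ, f t (x t)
    + β * ∑ t ∈ Finset.Icc 1 τ, max ((x (t - 1) : ℝ) - (x t : ℝ)) 0

/-- The set of final states `x τ` of minimizers of `C^L_τ`. -/
def FinalL (τ m : ℕ) (β : ℝ) (f : ℕ → ℕ → ℝ) : Set ℕ :=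
  {n | ∃ x : ℕ → ℕ, Feas τ m x ∧ x τ = n ∧
    ∀ y : ℕ → ℕ, Feas τ m y → CL τ β f x ≤ CL τ β f y}

/-- The set of final states `x τ` of minimizers of `C^U_τ`. -/
def FinalU (τ m : ℕ) (β : ℝ) (f : ℕ → ℕ → ℝ) : Set ℕ :=
  {n | ∃ x : ℕ → ℕ, Feas τ m x ∧ x τ = n ∧
    ∀ y : ℕ → ℕ, Feas τ m y → CU τ β f x ≤ CU τ β f y}

/-- Charging for powering up instead of powering down adds `β * x τ` to the cost. -/
theorem CL_eq_CU_add (τ : ℕ) (β : ℝ) (f : ℕ → ℕ → ℝ) (x : ℕ → ℕ) (hx : x 0 = 0) :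
    CL τ β f x = CU τ β f x + β * x τ := by
  have key : ∑ t ∈ Finset.Icc 1 τ, max ((x t : ℝ) - (x (t - 1) : ℝ)) 0
      = ∑ t ∈ Finset.Icc 1 τ, max ((x (t - 1) : ℝ) - (x t : ℝ)) 0 + x τ := by
    induction τ with
    | zero => simp [hx]
    | succ n ih =>
      rw [Finset.sum_Icc_succ_top (by omega), Finset.sum_Icc_succ_top (by omega), ih]
      have h := max_zero_sub_max_neg_zero_eq_self ((x (n + 1) : ℝ) - x n)
      rw [neg_sub] at h
      simp only [Nat.add_sub_cancel]
      linarith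
  unfold CL CU
  rw [key]
  ring

theorem FinalL_least_le_FinalU_greatest {τ m : ℕ} {β : ℝ} (hβ : 0 < β) {f : ℕ → ℕ → ℝ}
    {a b : ℕ} (ha : IsLeast (FinalL τ m β f) a) (hb : IsGreatest (FinalU τ m β f) b) :
    a ≤ b := by
  obtain ⟨x, hx, rfl, hxmin⟩ := ha.1
  obtain ⟨y, hy, rfl, hymin⟩ := hb.1
  have hL := hxmin y hy
  have hU := hymin x hx
  rw [CL_eq_CU_add τ β f x hx.1, CL_eq_CU_add τ β f y hy.1] at hL
  exact_mod_cast le_of_mul_le_mul_left (show β * (x τ : ℝ) ≤ β * y τ by linarith) hβ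

/-- If the LCP schedule crosses the backwards-optimal schedule `X*`,
they meet: if `x^LCP_{τ−1} < x*_{τ−1}` and `x^LCP_τ ≥ x*_τ` then `x^LCP_τ = x*_τ`,
and symmetrically. -/
theorem stmt9 (T m : ℕ) (β : ℝ) (hβ : 0 < β)
    (f : ℕ → ℕ → ℝ)
    (hconv : ∀ t ∈ Finset.Icc 1 T, ∀ a b : ℕ, a ≤ b → b + 1 ≤ m →
      f t (a + 1) - f t a ≤ f t (b + 1) - f t b)
    (hnonneg : ∀ t ∈ Finset.Icc 1 T, ∀ j : ℕ, j ≤ m → 0 ≤ f t j)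
    (xL xU : ℕ → ℕ)
    (hxL : ∀ τ ∈ Finset.Icc 1 T, IsLeast (FinalL τ m β f) (xL τ))
    (hxU : ∀ τ ∈ Finset.Icc 1 T, IsGreatest (FinalU τ m β f) (xU τ))
    -- the LCP schedule: x^LCP_0 = 0 and x^LCP_τ = [x^LCP_{τ−1}]_{x^L_τ}^{x^U_τ}
    (xlcp : ℕ → ℕ) (hlcp0 : xlcp 0 = 0)
    (hlcp : ∀ τ ∈ Finset.Icc 1 T, xlcp τ = max (xL τ) (min (xU τ) (xlcp (τ - 1))))
    -- the optimal schedule defined by the backward recursion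
    (xstar : ℕ → ℕ) (hstar0 : xstar 0 = 0) (hstarT1 : xstar (T + 1) = 0)
    (hstar : ∀ t ∈ Finset.Icc 1 T, xstar t = max (xL t) (min (xU t) (xstar (t + 1)))) :
    ∀ τ ∈ Finset.Icc 1 T,
      (xlcp (τ - 1) < xstar (τ - 1) → xstar τ ≤ xlcp τ → xlcp τ = xstar τ) ∧
      (xstar (τ - 1) < xlcp (τ - 1) → xlcp τ ≤ xstar τ → xlcp τ = xstar τ) := by
  intro τ hτ
  obtain ⟨h1, hT⟩ := Finset.mem_Icc.1 hτ
  obtain rfl | hτ2 := h1.eq_or_lt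
  · simp [hlcp0, hstar0]
  have hp : τ - 1 ∈ Finset.Icc 1 T := Finset.mem_Icc.2 ⟨by omega, by omega⟩
  have hLU := FinalL_least_le_FinalU_greatest hβ (hxL τ hτ) (hxU τ hτ)
  have hLU' := FinalL_least_le_FinalU_greatest hβ (hxL _ hp) (hxU _ hp)
  have hlcpτ := hlcp τ hτ
  have hlcpp := hlcp _ hp
  have hstarτ := hstar τ hτ
  have hstarp := hstar _ hp
  rw [Nat.sub_add_cancel h1] at hstarp
  constructor <;> intro _ _ <;> omega
end
end

section
/- Let X^LCP be the Lazy Capacity Provisioning schedule and let X* be the optimal schedule defined by the backward recursion x*_{T+1} = 0, x*_t = [x*_{t+1}]_{x^L_t}^{x^U_t}. Then the operating cost of LCP satisfies Σ_{t=1}^T f_t(x^LCP_t) ≤ Σ_{t=1}^T f_t(x*_t) + β Σ_{t=1}^T |x*_t − x*_{t−1}| (with x*_0 = 0). -/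
open Finset

noncomputable section

/-- Discrete convexity on `{0, …, m}`. -/
def ConvexUpTo (m : ℕ) (h : ℕ → ℝ) : Prop :=
  ∀ a b : ℕ, a ≤ b → b + 1 ≤ m → h (a + 1) - h a ≤ h (b + 1) - h b

/-- Infimal convolution of `W` on `{0, …, m}` with the powering-up cost `z ↦ β z⁺`. -/
def upRelax (m : ℕ) (β : ℝ) (W : ℕ → ℝ) (x : ℕ) : ℝ :=
  (range (m + 1)).inf' nonempty_range_add_one fun y => W y + β * max ((x : ℝ) - y) 0

/-- The least cost of being able to enter slot `t + 1` in state `x`, powering-up costs of the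
transition included. -/
def relaxedCost (m : ℕ) (β : ℝ) (f : ℕ → ℕ → ℝ) : ℕ → ℕ → ℝ
  | 0 => fun x => β * x
  | t + 1 => upRelax m β fun y => f (t + 1) y + relaxedCost m β f t y

namespace ConvexUpTo

variable {m : ℕ} {h g : ℕ → ℝ}

theorem add (hh : ConvexUpTo m h) (hg : ConvexUpTo m g) : ConvexUpTo m fun x => h x + g x := by
  intro a b hab hb
  linarith [hh a b hab hb, hg a b hab hb]

theorem sub_linear (hh : ConvexUpTo m h) (c : ℝ) : ConvexUpTo m fun x => h x - c * x := by
  intro a b hab hb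
  push_cast
  linarith [hh a b hab hb]

theorem le_of_min_le (hh : ConvexUpTo m h) {n x y : ℕ} (hn : ∀ z ≤ m, h n ≤ h z)
    (hnx : n ≤ x) (hxy : x ≤ y) (hy : y ≤ m) : h x ≤ h y := by
  induction y, hxy using Nat.le_induction with
  | base => exact le_rfl
  | succ k hk ih =>
    linarith [ih (by omega), hh n k (by omega) hy, hn (n + 1) (by omega)]

theorem le_of_le_min (hh : ConvexUpTo m h) {n x y : ℕ} (hn : ∀ z ≤ m, h n ≤ h z)
    (hnm : n ≤ m) (hxy : x ≤ y) (hy : y ≤ n) : h y ≤ h x := by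
  induction y, hxy using Nat.le_induction with
  | base => exact le_rfl
  | succ k hk ih =>
    obtain ⟨p, rfl⟩ : ∃ p, n = p + 1 := ⟨n - 1, by omega⟩
    linarith [ih (by omega), hh k p (by omega) hnm, hn p (by omega)]

end ConvexUpTo

section Relaxation

variable {m : ℕ} {β : ℝ} {W : ℕ → ℝ}

theorem upRelax_le (x : ℕ) {y : ℕ} (hy : y ≤ m) :
    upRelax m β W x ≤ W y + β * max ((x : ℝ) - y) 0 :=
  inf'_le (fun y : ℕ => W y + β * max ((x : ℝ) - y) 0) (mem_range.2 (by omega))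

theorem exists_upRelax_eq (m : ℕ) (β : ℝ) (W : ℕ → ℝ) (x : ℕ) :
    ∃ y ≤ m, upRelax m β W x = W y + β * max ((x : ℝ) - y) 0 := by
  obtain ⟨y, hy, h⟩ := exists_mem_eq_inf' (nonempty_range_add_one (n := m))
    fun y : ℕ => W y + β * max ((x : ℝ) - y) 0
  exact ⟨y, by simpa [Nat.lt_succ_iff] using hy, h⟩

theorem upRelax_sub_le (hβ : 0 ≤ β) (a b : ℕ) :
    upRelax m β W a - upRelax m β W b ≤ β * max ((a : ℝ) - b) 0 := by
  obtain ⟨y, hy, h⟩ := exists_upRelax_eq m β W b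
  have h1 := upRelax_le (β := β) (W := W) a hy
  have h2 : max ((a : ℝ) - y) 0 ≤ max ((a : ℝ) - b) 0 + max ((b : ℝ) - y) 0 := by
    grind
  nlinarith [mul_le_mul_of_nonneg_left h2 hβ]

theorem convexUpTo_upRelax (hβ : 0 ≤ β) (hW : ConvexUpTo m W) :
    ConvexUpTo m (upRelax m β W) := by
  intro a b hab _
  obtain ⟨y, hy, h⟩ := exists_upRelax_eq m β W a
  obtain ⟨z, hz, h'⟩ := exists_upRelax_eq m β W (b + 1)
  rcases lt_or_ge y z with hyz | hyz
  · obtain ⟨w, rfl⟩ : ∃ w, z = w + 1 := ⟨z - 1, by omega⟩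
    have h1 := upRelax_le (β := β) (W := W) (a + 1) (show y + 1 ≤ m by omega)
    have h2 := upRelax_le (β := β) (W := W) b (show w ≤ m by omega)
    have h3 := hW y w (by omega) hz
    push_cast at h1 h'
    rw [add_sub_add_right_eq_sub] at h1 h'
    linarith
  · have h1 := upRelax_le (β := β) (W := W) (a + 1) hy
    have h2 := upRelax_le (β := β) (W := W) b hz
    have h3 : max (((a + 1 : ℕ) : ℝ) - y) 0 + max ((b : ℝ) - z) 0
        ≤ max ((a : ℝ) - y) 0 + max (((b + 1 : ℕ) : ℝ) - z) 0 := by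
      have hab' : (a : ℝ) ≤ b := mod_cast hab
      have hyz' : (z : ℝ) ≤ y := mod_cast hyz
      push_cast
      grind
    nlinarith [mul_le_mul_of_nonneg_left h3 hβ]

theorem upRelax_eq_of_mem (hβ : 0 ≤ β) (hW : ConvexUpTo m W) {l u x : ℕ}
    (hl : ∀ z ≤ m, W l ≤ W z) (hu : ∀ z ≤ m, W u - β * u ≤ W z - β * z) (hum : u ≤ m)
    (hlx : l ≤ x) (hxu : x ≤ u) : upRelax m β W x = W x := by
  apply le_antisymm
  · simpa using upRelax_le (β := β) (W := W) x (hxu.trans hum)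
  · obtain ⟨y, hy, h⟩ := exists_upRelax_eq m β W x
    rw [h]
    rcases le_total x y with hxy | hxy
    · have h1 := hW.le_of_min_le hl hlx hxy hy
      have h2 : 0 ≤ β * max ((x : ℝ) - y) 0 := mul_nonneg hβ (le_max_right _ _)
      linarith
    · have h1 := (hW.sub_linear β).le_of_le_min hu hum hxy hxu
      have h2 := mul_le_mul_of_nonneg_left (le_max_left ((x : ℝ) - y) 0) hβ
      linarith

end Relaxation

section Schedules

variable {m : ℕ} {β : ℝ} {f : ℕ → ℕ → ℝ}

theorem Feas.mono {s t : ℕ} {x : ℕ → ℕ} (hx : Feas t m x) (hst : s ≤ t) : Feas s m x :=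
  ⟨hx.1, fun r hr => hx.2 r (Icc_subset_Icc_right hst hr)⟩

theorem CL_succ (t : ℕ) (x : ℕ → ℕ) :
    CL (t + 1) β f x
      = CL t β f x + f (t + 1) (x (t + 1)) + β * max ((x (t + 1) : ℝ) - x t) 0 := by
  simp only [CL, sum_Icc_succ_top (Nat.le_add_left 1 t), Nat.add_sub_cancel]
  ring

theorem CL_congr {t : ℕ} {x y : ℕ → ℕ} (h : ∀ s ≤ t, x s = y s) : CL t β f x = CL t β f y := by
  unfold CL
  congr 1
  · exact sum_congr rfl fun s hs => by rw [h s (mem_Icc.1 hs).2]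
  · congr 1
    refine sum_congr rfl fun s hs => ?_
    have := (mem_Icc.1 hs).2
    rw [h s this, h (s - 1) (by omega)]

theorem CU_eq (t : ℕ) {x : ℕ → ℕ} (hx : x 0 = 0) : CU t β f x = CL t β f x - β * x t := by
  induction t with
  | zero => simp [CU, CL, hx]
  | succ t ih =>
    have h : CU (t + 1) β f x
        = CU t β f x + f (t + 1) (x (t + 1)) + β * max ((x t : ℝ) - x (t + 1)) 0 := by
      simp only [CU, sum_Icc_succ_top (Nat.le_add_left 1 t), Nat.add_sub_cancel]
      ring
    have h2 : max ((x t : ℝ) - x (t + 1)) 0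
        = max ((x (t + 1) : ℝ) - x t) 0 - x (t + 1) + x t := by
      grind
    rw [h, ih, CL_succ, h2]
    ring

theorem relaxedCost_le (t : ℕ) {x : ℕ → ℕ} (hx : Feas t m x) (z : ℕ) :
    relaxedCost m β f t z ≤ CL t β f x + β * max ((z : ℝ) - x t) 0 := by
  induction t generalizing z with
  | zero => simp [relaxedCost, CL, hx.1]
  | succ t ih =>
    have h1 := upRelax_le (β := β) (W := fun y => f (t + 1) y + relaxedCost m β f t y) z
      (hx.2 (t + 1) (by simp))
    have h2 := ih (hx.mono t.le_succ) (x (t + 1))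
    rw [CL_succ, relaxedCost]
    linarith

theorem exists_schedule_extension {t y : ℕ} {x : ℕ → ℕ} (hx : Feas t m x) (hy : y ≤ m) :
    ∃ x', Feas (t + 1) m x' ∧ x' (t + 1) = y ∧
      CL (t + 1) β f x' = CL t β f x + f (t + 1) y + β * max ((y : ℝ) - x t) 0 := by
  refine ⟨Function.update x (t + 1) y, ⟨by simp [hx.1], fun s hs => ?_⟩, by simp, ?_⟩
  · rcases eq_or_ne s (t + 1) with rfl | hne
    · simpa using hy
    · rw [Function.update_of_ne hne]
      simp only [mem_Icc] at hs
      exact hx.2 s (mem_Icc.2 (by omega))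
  · have hc : CL t β f (Function.update x (t + 1) y) = CL t β f x :=
      CL_congr fun s hs => Function.update_of_ne (by omega) _ _
    have ht : Function.update x (t + 1) y t = x t := Function.update_of_ne (by omega) _ _
    rw [CL_succ, hc, Function.update_self, ht]

theorem exists_schedule_relaxedCost (t z : ℕ) :
    ∃ x, Feas t m x ∧ CL t β f x + β * max ((z : ℝ) - x t) 0 = relaxedCost m β f t z := by
  induction t generalizing z with
  | zero => exact ⟨fun _ => 0, ⟨rfl, by simp⟩, by simp [relaxedCost, CL]⟩
  | succ t ih =>
    obtain ⟨y, hy, h⟩ := exists_upRelax_eq m β (fun y => f (t + 1) y + relaxedCost m β f t y) z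
    obtain ⟨x, hx, hxy⟩ := ih y
    obtain ⟨x', hx', hend, hcost⟩ := exists_schedule_extension (β := β) (f := f) hx hy
    refine ⟨x', hx', ?_⟩
    rw [hcost, hend, relaxedCost, h]
    linarith

theorem exists_schedule_ending_at (t : ℕ) {z : ℕ} (hz : z ≤ m) :
    ∃ x, Feas (t + 1) m x ∧ x (t + 1) = z ∧
      CL (t + 1) β f x = f (t + 1) z + relaxedCost m β f t z := by
  obtain ⟨x, hx, hxz⟩ := exists_schedule_relaxedCost (m := m) (β := β) (f := f) t z
  obtain ⟨x', hx', hend, hcost⟩ := exists_schedule_extension (β := β) (f := f) hx hz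
  exact ⟨x', hx', hend, by linarith⟩

theorem add_relaxedCost_le_CL (t : ℕ) {x : ℕ → ℕ} (hx : Feas (t + 1) m x) :
    f (t + 1) (x (t + 1)) + relaxedCost m β f t (x (t + 1)) ≤ CL (t + 1) β f x := by
  rw [CL_succ]
  linarith [relaxedCost_le (β := β) (f := f) t (hx.mono t.le_succ) (x (t + 1))]

theorem le_of_mem_FinalL {t n : ℕ} (hn : n ∈ FinalL (t + 1) m β f) {z : ℕ} (hz : z ≤ m) :
    f (t + 1) n + relaxedCost m β f t n ≤ f (t + 1) z + relaxedCost m β f t z := by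
  obtain ⟨x, hx, rfl, hmin⟩ := hn
  obtain ⟨y, hy, -, hyz⟩ := exists_schedule_ending_at (β := β) (f := f) t hz
  exact (add_relaxedCost_le_CL t hx).trans ((hmin y hy).trans hyz.le)

theorem le_of_mem_FinalU {t n : ℕ} (hn : n ∈ FinalU (t + 1) m β f) {z : ℕ} (hz : z ≤ m) :
    f (t + 1) n + relaxedCost m β f t n - β * n
      ≤ f (t + 1) z + relaxedCost m β f t z - β * z := by
  obtain ⟨x, hx, rfl, hmin⟩ := hn
  obtain ⟨y, hy, hyz, hcost⟩ := exists_schedule_ending_at (β := β) (f := f) t hz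
  have h := hmin y hy
  rw [CU_eq _ hx.1, CU_eq _ hy.1, hyz] at h
  linarith [add_relaxedCost_le_CL (β := β) (f := f) t hx]

theorem mem_FinalL_le {t n : ℕ} (hn : n ∈ FinalL (t + 1) m β f) : n ≤ m := by
  obtain ⟨x, hx, rfl, -⟩ := hn
  exact hx.2 _ (by simp)

theorem mem_FinalU_le {t n : ℕ} (hn : n ∈ FinalU (t + 1) m β f) : n ≤ m := by
  obtain ⟨x, hx, rfl, -⟩ := hn
  exact hx.2 _ (by simp)

theorem FinalL_le_FinalU (hβ : 0 < β) {t l u : ℕ} (hl : l ∈ FinalL (t + 1) m β f)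
    (hu : u ∈ FinalU (t + 1) m β f) : l ≤ u := by
  by_contra! hlt
  have h1 := le_of_mem_FinalL hl (mem_FinalU_le hu)
  have h2 := le_of_mem_FinalU hu (mem_FinalL_le hl)
  have h3 : (u : ℝ) < l := mod_cast hlt
  nlinarith

theorem relaxedCost_sub_le (hβ : 0 ≤ β) (t a b : ℕ) :
    relaxedCost m β f t a - relaxedCost m β f t b ≤ β * max ((a : ℝ) - b) 0 := by
  cases t with
  | zero =>
    rw [relaxedCost, ← mul_sub]
    exact mul_le_mul_of_nonneg_left (le_max_left _ _) hβ
  | succ t => exact upRelax_sub_le hβ a b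

theorem convexUpTo_relaxedCost (hβ : 0 ≤ β) (t : ℕ)
    (hf : ∀ s ∈ Icc 1 t, ConvexUpTo m (f s)) : ConvexUpTo m (relaxedCost m β f t) := by
  induction t with
  | zero =>
    intro a b _ _
    simp only [relaxedCost]
    push_cast
    linarith
  | succ t ih =>
    exact convexUpTo_upRelax hβ ((hf (t + 1) (by simp)).add
      (ih fun s hs => hf s (Icc_subset_Icc_right t.le_succ hs)))

theorem relaxedCost_succ_eq (hβ : 0 ≤ β) {t : ℕ} (hf : ∀ s ∈ Icc 1 (t + 1), ConvexUpTo m (f s))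
    {l u x : ℕ} (hl : l ∈ FinalL (t + 1) m β f) (hu : u ∈ FinalU (t + 1) m β f)
    (hlx : l ≤ x) (hxu : x ≤ u) :
    relaxedCost m β f (t + 1) x = f (t + 1) x + relaxedCost m β f t x :=
  upRelax_eq_of_mem hβ
    ((hf (t + 1) (by simp)).add
      (convexUpTo_relaxedCost hβ t fun s hs => hf s (Icc_subset_Icc_right t.le_succ hs)))
    (fun _ hz => le_of_mem_FinalL hl hz) (fun _ hz => le_of_mem_FinalU hu hz)
    (mem_FinalU_le hu) hlx hxu

end Schedules

/-- If `a` moves towards `s'` without crossing it while `s` moves to `s'`, the decrease of `a` and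
the increase of `s` are paid for by the movement of `s` and the decrease of `(a - s)⁺`. -/
theorem pos_part_potential_le {a a' s s' : ℝ}
    (h : (s' ≤ a' ∧ a' ≤ a) ∨ (a ≤ a' ∧ a' ≤ s')) :
    max (a - a') 0 + max (s' - s) 0 + max (a' - s') 0 ≤ max (a - s) 0 + |s' - s| := by
  grind

/-- The operating cost of the LCP schedule is at most the operating
cost of the backwards-optimal schedule `X*` plus `β ∑_{t=1}^T |x*_t − x*_{t−1}|`. -/
theorem stmt11 (T m : ℕ) (β : ℝ) (hβ : 0 < β)
    (f : ℕ → ℕ → ℝ)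
    (hconv : ∀ t ∈ Finset.Icc 1 T, ∀ a b : ℕ, a ≤ b → b + 1 ≤ m →
      f t (a + 1) - f t a ≤ f t (b + 1) - f t b)
    (hnonneg : ∀ t ∈ Finset.Icc 1 T, ∀ j : ℕ, j ≤ m → 0 ≤ f t j)
    (xL xU : ℕ → ℕ)
    (hxL : ∀ τ ∈ Finset.Icc 1 T, IsLeast (FinalL τ m β f) (xL τ))
    (hxU : ∀ τ ∈ Finset.Icc 1 T, IsGreatest (FinalU τ m β f) (xU τ))
    (xlcp : ℕ → ℕ) (hlcp0 : xlcp 0 = 0)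
    (hlcp : ∀ τ ∈ Finset.Icc 1 T, xlcp τ = max (xL τ) (min (xU τ) (xlcp (τ - 1))))
    (xstar : ℕ → ℕ) (hstar0 : xstar 0 = 0) (hstarT1 : xstar (T + 1) = 0)
    (hstar : ∀ t ∈ Finset.Icc 1 T, xstar t = max (xL t) (min (xU t) (xstar (t + 1)))) :
    ∑ t ∈ Finset.Icc 1 T, f t (xlcp t)
      ≤ ∑ t ∈ Finset.Icc 1 T, f t (xstar t)
        + β * ∑ t ∈ Finset.Icc 1 T, |(xstar t : ℝ) - (xstar (t - 1) : ℝ)| := by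
  have key : ∀ n ≤ T, ∑ t ∈ Icc 1 n, f t (xlcp t)
      ≤ ∑ t ∈ Icc 1 n, f t (xstar t)
        + β * ∑ t ∈ Icc 1 n, |(xstar t : ℝ) - (xstar (t - 1) : ℝ)|
        + (relaxedCost m β f n (xlcp n) - relaxedCost m β f n (xstar n))
        - β * max ((xlcp n : ℝ) - xstar n) 0 := by
    intro n
    induction n with
    | zero => simp [hlcp0, hstar0]
    | succ n ih =>
      intro hn
      have hmem : n + 1 ∈ Icc 1 T := mem_Icc.2 ⟨by omega, hn⟩
      have hL := (hxL _ hmem).1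
      have hU := (hxU _ hmem).1
      have hLU := FinalL_le_FinalU hβ hL hU
      have ha := hlcp _ hmem
      have hs := hstar _ hmem
      rw [Nat.add_sub_cancel] at ha
      have hf : ∀ s ∈ Icc 1 (n + 1), ConvexUpTo m (f s) :=
        fun s hs => hconv s (Icc_subset_Icc_right hn hs)
      have h1 := relaxedCost_succ_eq hβ.le hf hL hU (x := xlcp (n + 1)) (by omega) (by omega)
      have h2 := relaxedCost_succ_eq hβ.le hf hL hU (x := xstar (n + 1)) (by omega) (by omega)
      have h3 := relaxedCost_sub_le (m := m) (f := f) hβ.le n (xlcp n) (xlcp (n + 1))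
      have h4 := relaxedCost_sub_le (m := m) (f := f) hβ.le n (xstar (n + 1)) (xstar n)
      have hbetween : (xstar (n + 1) ≤ xlcp (n + 1) ∧ xlcp (n + 1) ≤ xlcp n) ∨
          (xlcp n ≤ xlcp (n + 1) ∧ xlcp (n + 1) ≤ xstar (n + 1)) := by omega
      have h5 := mul_le_mul_of_nonneg_left
        (pos_part_potential_le (a := xlcp n) (a' := xlcp (n + 1)) (s := xstar n)
          (s' := xstar (n + 1)) (mod_cast hbetween)) hβ.le
      simp only [sum_Icc_succ_top (Nat.le_add_left 1 n), Nat.add_sub_cancel]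
      linarith [ih (by omega)]
  linarith [key T le_rfl, relaxedCost_sub_le (m := m) (f := f) hβ.le T (xlcp T) (xstar T)]
end
end
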